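/- arXiv:math/0008187 — 2 statements merged into one kernel-verified Lean document; each statement's English description precedes it below -/
import Mathlib

section
/- For every integer n ≥ 2, if two Jones normal form data (l, k, a_1 < … < a_k, b_1 < … < b_k) and (l', k', c_1 < … < c_{k'}, d_1 < … < d_{k'}) determine equal elements c^l h^{[b_1,a_1]} ⋯ h^{[b_k,a_k]} = c^{l'} h^{[d_1,c_1]} ⋯ h^{[d_{k'},c_{k'}]} of the Kauffman monoid K_n, then l = l', k = k', a_t = c_t and b_t = d_t for all t. -/
/-!
Kauffman monoid `K n` for `n ≥ 2`: presented by generators `h^1, …, h^{n-1}`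
(diapsides) and `c` (circle), subject to
`h^i h^j = h^j h^i` for `|i-j| ≥ 2`, `h^i h^{i±1} h^i = h^i`,
`h^i c = c h^i`, `h^i h^i = c h^i`.
-/

namespace Kauffman

/-- Valid diapsis indices `1 ≤ i ≤ n-1`. -/
def Idx (n : ℕ) : Type := {i : ℕ // 1 ≤ i ∧ i ≤ n - 1}

/-- Generators of the Kauffman monoid. -/
inductive Gen (n : ℕ) : Type
  | h : Idx n → Gen n
  | c : Gen n

/-- The defining relations of the Kauffman monoid. -/
inductive Rel (n : ℕ) : FreeMonoid (Gen n) → FreeMonoid (Gen n) → Prop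
  | comm (i j : Idx n) (hij : i.1 + 2 ≤ j.1 ∨ j.1 + 2 ≤ i.1) :
      Rel n (FreeMonoid.of (Gen.h i) * FreeMonoid.of (Gen.h j))
            (FreeMonoid.of (Gen.h j) * FreeMonoid.of (Gen.h i))
  | absorb (i j : Idx n) (hij : j.1 = i.1 + 1 ∨ i.1 = j.1 + 1) :
      Rel n (FreeMonoid.of (Gen.h i) * FreeMonoid.of (Gen.h j) * FreeMonoid.of (Gen.h i))
            (FreeMonoid.of (Gen.h i))
  | hc (i : Idx n) :
      Rel n (FreeMonoid.of (Gen.h i) * FreeMonoid.of Gen.c)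
            (FreeMonoid.of Gen.c * FreeMonoid.of (Gen.h i))
  | hh (i : Idx n) :
      Rel n (FreeMonoid.of (Gen.h i) * FreeMonoid.of (Gen.h i))
            (FreeMonoid.of Gen.c * FreeMonoid.of (Gen.h i))

/-- The congruence generated by the Kauffman relations. -/
def kcon (n : ℕ) : Con (FreeMonoid (Gen n)) := conGen (Rel n)

/-- The Kauffman monoid `K n`. -/
abbrev K (n : ℕ) : Type := (kcon n).Quotient

/-- The diapsis `h^i` as an element of `K n` (defined to be `1` for out-of-range `i`). -/
def hK (n i : ℕ) : K n :=
  if h : 1 ≤ i ∧ i ≤ n - 1 then ((FreeMonoid.of (Gen.h ⟨i, h⟩) : FreeMonoid (Gen n)) : K n)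
  else 1

/-- The circle `c` as an element of `K n`. -/
def cK (n : ℕ) : K n := ((FreeMonoid.of Gen.c : FreeMonoid (Gen n)) : K n)

/-- The block `h^{[i,j]} = h^i h^{i-1} ⋯ h^{j+1} h^j` (for `j ≤ i`). -/
def block (n i j : ℕ) : K n :=
  (((List.range (i + 1 - j)).map fun t => hK n (i - t))).prod

end Kauffman

namespace Kauffman

/-- A perfect matching of the points of `α`, given by its partner function. -/
@[ext]
structure Matching (α : Type*) where
  /-- The partner of a point. -/
  partner : α → α
  partner_partner : ∀ x, partner (partner x) = x
  partner_ne : ∀ x, partner x ≠ x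

namespace Matching

variable {α : Type*}

/-- The action of a circle on a matching together with a number of circles. -/
def circle : Function.End (Matching α × ℕ) := fun s => (s.1, s.2 + 1)

theorem circle_pow_apply (l : ℕ) (s : Matching α × ℕ) :
    ((circle : Function.End (Matching α × ℕ)) ^ l) s = (s.1, s.2 + l) := by
  induction l with
  | zero => rfl
  | succ l ih =>
    rw [pow_succ']
    change circle ((circle ^ l) s) = _
    rw [ih]
    rfl

variable [DecidableEq α]

/-- Match `p` with `q`, and the former partners of `p` and `q` with each other. -/
def join (p q : α) (hpq : p ≠ q) (f : Matching α) : Matching α where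
  partner x :=
    if x = p then q else if x = q then p else
    if x = f.partner p then f.partner q else if x = f.partner q then f.partner p else f.partner x
  partner_partner x := by
    have h1 := f.partner_partner
    have h2 := f.partner_ne
    grind
  partner_ne x := by
    have h1 := f.partner_partner
    have h2 := f.partner_ne
    grind

theorem join_partner (p q : α) (hpq : p ≠ q) (f : Matching α) (x : α) :
    (f.join p q hpq).partner x =
      if x = p then q else if x = q then p else
      if x = f.partner p then f.partner q else
      if x = f.partner q then f.partner p else f.partner x := rfl

/-- The action of a diapsis on a matching together with a number of circles. -/
def diapsis (p q : α) (hpq : p ≠ q) : Function.End (Matching α × ℕ) := fun s =>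
  (s.1.join p q hpq, if s.1.partner p = q then s.2 + 1 else s.2)

theorem diapsis_mul_circle (p q : α) (hpq : p ≠ q) :
    diapsis p q hpq * circle = circle * diapsis p q hpq := by
  funext s
  change diapsis p q hpq (circle s) = circle (diapsis p q hpq s)
  exact Prod.ext rfl (by grind [diapsis, circle])

theorem diapsis_mul_self (p q : α) (hpq : p ≠ q) :
    diapsis p q hpq * diapsis p q hpq = circle * diapsis p q hpq := by
  funext s
  change diapsis p q hpq (diapsis p q hpq s) = circle (diapsis p q hpq s)
  refine Prod.ext (Matching.ext (funext fun x => ?_)) ?_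
  · have h1 := s.1.partner_partner
    simp only [diapsis, circle, join_partner]
    grind
  · simp [diapsis, circle, join_partner]

theorem diapsis_comm (p q : α) (hpq : p ≠ q) : diapsis p q hpq = diapsis q p hpq.symm := by
  funext s
  have h1 := s.1.partner_partner
  have h2 := s.1.partner_ne
  refine Prod.ext (Matching.ext (funext fun x => ?_)) ?_
  · simp only [diapsis, join_partner]
    grind
  · simp only [diapsis]
    grind

theorem diapsis_mul_mul_cancel (p q r : α) (hpq : p ≠ q) (hqr : q ≠ r) (hpr : p ≠ r) :
    diapsis p q hpq * diapsis q r hqr * diapsis p q hpq = diapsis p q hpq := by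
  funext s
  change diapsis p q hpq (diapsis q r hqr (diapsis p q hpq s)) = diapsis p q hpq s
  have h1 := s.1.partner_partner
  have h2 := s.1.partner_ne
  refine Prod.ext (Matching.ext (funext fun x => ?_)) ?_
  · simp only [diapsis, join_partner]
    grind
  · simp only [diapsis, join_partner]
    grind

theorem diapsis_commute (p q r t : α) (hpq : p ≠ q) (hrt : r ≠ t)
    (hpr : p ≠ r) (hpt : p ≠ t) (hqr : q ≠ r) (hqt : q ≠ t) :
    diapsis p q hpq * diapsis r t hrt = diapsis r t hrt * diapsis p q hpq := by
  funext s
  change diapsis p q hpq (diapsis r t hrt s) = diapsis r t hrt (diapsis p q hpq s)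
  have h1 := s.1.partner_partner
  have h2 := s.1.partner_ne
  refine Prod.ext (Matching.ext (funext fun x => ?_)) ?_
  · simp only [diapsis, join_partner]
    grind (splits := 30)
  · simp only [diapsis, join_partner]
    grind (splits := 30)

end Matching

open Matching

/-- The diapsis `h^i` acting on matchings of the top points `(j, true)` and the
bottom points `(j, false)`. -/
def diapsisAt (i : ℕ) : Function.End (Matching (ℕ × Bool) × ℕ) :=
  diapsis (i, true) (i + 1, true) (by simp)

theorem diapsisAt_mul_succ_mul (i : ℕ) :
    diapsisAt i * diapsisAt (i + 1) * diapsisAt i = diapsisAt i :=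
  diapsis_mul_mul_cancel _ _ _ _ _ (by simp; omega)

theorem diapsisAt_succ_mul_mul_succ (i : ℕ) :
    diapsisAt (i + 1) * diapsisAt i * diapsisAt (i + 1) = diapsisAt (i + 1) := by
  rw [diapsisAt, diapsisAt, diapsis_comm (i + 1, true), diapsis_comm (i, true)]
  exact diapsis_mul_mul_cancel _ _ _ _ _ (by simp; omega)

/-- The action of `K n` by left multiplication on diagrams with circles. -/
def action (n : ℕ) : K n →* Function.End (Matching (ℕ × Bool) × ℕ) :=
  (kcon n).lift
    (FreeMonoid.lift fun g => match g with
      | Gen.h i => diapsisAt i.1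
      | Gen.c => circle)
    (Con.conGen_le.mpr fun x y h => by
      rw [Con.ker_rel]
      cases h with
      | comm i j hij =>
        simp only [map_mul, FreeMonoid.lift_eval_of]
        apply diapsis_commute <;> simp <;> omega
      | absorb i j hij =>
        simp only [map_mul, FreeMonoid.lift_eval_of]
        rcases hij with hij | hij
        · exact hij ▸ diapsisAt_mul_succ_mul i.1
        · exact hij ▸ diapsisAt_succ_mul_mul_succ j.1
      | hc i =>
        simp only [map_mul, FreeMonoid.lift_eval_of]
        apply diapsis_mul_circle
      | hh i =>
        simp only [map_mul, FreeMonoid.lift_eval_of]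
        apply diapsis_mul_self)

theorem action_cK (n : ℕ) : action n (cK n) = circle := rfl

theorem action_hK (n i : ℕ) (h1 : 1 ≤ i) (h2 : i ≤ n - 1) :
    action n (hK n i) = diapsisAt i := by
  rw [hK, dif_pos ⟨h1, h2⟩]
  rfl

/-- The diagram of the unit of `K n`. -/
def unitMatching : Matching (ℕ × Bool) where
  partner x := (x.1, !x.2)
  partner_partner x := by simp
  partner_ne x := by simp [Prod.ext_iff]

/-- `f` is the identity diagram to the left of `m`, the top points joined to a point further left
are those at the positions in `S`, and the bottom points joined to a point further right are those
at the positions in `T`. -/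
structure HasShape (f : Matching (ℕ × Bool)) (m : ℕ) (S T : Set ℕ) : Prop where
  left : ∀ x < m, f.partner (x, true) = (x, false)
  top : ∀ x, (f.partner (x, true)).1 < x ↔ x ∈ S
  bottom : ∀ x, x < (f.partner (x, false)).1 ↔ x ∈ T

theorem hasShape_unitMatching (m : ℕ) : HasShape unitMatching m ∅ ∅ := by
  constructor <;> simp [unitMatching]

theorem HasShape.mono {f : Matching (ℕ × Bool)} {m m' : ℕ} {S T : Set ℕ} (h : HasShape f m S T)
    (hm : m' ≤ m) : HasShape f m' S T :=
  ⟨fun x hx => h.left x (hx.trans_le hm), h.top, h.bottom⟩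

theorem HasShape.diapsisAt_first {f : Matching (ℕ × Bool)} {m : ℕ} {S T : Set ℕ}
    (h : HasShape f (m + 1) S T) (hS : m + 1 ∉ S) (l : ℕ) :
    ∃ g, diapsisAt m (f, l) = (g, l) ∧ HasShape g m (insert (m + 1) S) (insert m T) := by
  have h1 := f.partner_partner
  have h2 := f.partner_ne
  have h3 := h.left
  have h4 := h.top
  have h5 := h.bottom
  have h6 := h3 m (by omega)
  refine ⟨_, Prod.ext rfl ?_, ?_, ?_, ?_⟩
  · simp [diapsisAt, diapsis, h6]
  · intro x hx
    have := h3 x (by omega)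
    simp only [diapsisAt, diapsis, join_partner]
    grind
  · intro x
    have := h4 x
    have := h4 (m+1)
    simp only [diapsisAt, diapsis, join_partner, Set.mem_insert_iff]
    grind
  · intro x
    have := h5 x
    have := h4 (m+1)
    simp only [diapsisAt, diapsis, join_partner, Set.mem_insert_iff]
    grind

theorem HasShape.diapsisAt_next {f : Matching (ℕ × Bool)} {m i : ℕ} {S T : Set ℕ}
    (h : HasShape f m (insert i S) T) (hm : m < i) (hi : i ∉ S) (hS : i + 1 ∉ S) (l : ℕ) :
    ∃ g, diapsisAt i (f, l) = (g, l) ∧ HasShape g m (insert (i + 1) S) T := by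
  have h1 := f.partner_partner
  have h2 := f.partner_ne
  have h3 := h.left
  have h4 := h.top
  have h5 := h.bottom
  have h6 : (f.partner (i, true)).1 < i := (h4 i).2 (Set.mem_insert i S)
  have h7 : ¬ (f.partner (i + 1, true)).1 < i + 1 := by simp [h4, hS]
  refine ⟨_, Prod.ext rfl ?_, ?_, ?_, ?_⟩
  · simp only [diapsisAt, diapsis]
    grind
  · intro x hx
    have := h3 x (by omega)
    simp only [diapsisAt, diapsis, join_partner]
    grind
  · intro x
    have := h4 x
    simp only [diapsisAt, diapsis, join_partner, Set.mem_insert_iff] at *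
    grind
  · intro x
    have := h5 x
    simp only [diapsisAt, diapsis, join_partner, Set.mem_insert_iff] at *
    grind

theorem block_self (n i : ℕ) : block n i i = hK n i := by
  simp [block]

theorem block_succ (n i j : ℕ) (h : j ≤ i) : block n (i + 1) j = hK n (i + 1) * block n i j := by
  have : i + 1 + 1 - j = (i + 1 - j) + 1 := by omega
  rw [block, this, List.range_succ_eq_map, List.map_cons, List.prod_cons, List.map_map, block]
  congr 3
  funext t
  simp

theorem HasShape.action_block {f : Matching (ℕ × Bool)} {n i j : ℕ} {S T : Set ℕ}
    (h : HasShape f (j + 1) S T) (hj : 1 ≤ j) (hji : j ≤ i) (hi : i ≤ n - 1)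
    (hS : ∀ x ∈ S, i + 1 < x) (l : ℕ) :
    ∃ g, action n (block n i j) (f, l) = (g, l) ∧
      HasShape g j (insert (i + 1) S) (insert j T) := by
  induction i, hji using Nat.le_induction with
  | base =>
    rw [block_self, action_hK n j hj hi]
    exact h.diapsisAt_first (fun hx => (hS _ hx).false) l
  | succ i hji ih =>
    obtain ⟨g, hg, hg'⟩ := ih (by omega) fun x hx => by have := hS x hx; omega
    rw [block_succ n i j hji, map_mul, action_hK n (i + 1) (by omega) hi]
    obtain ⟨g', h1, h2⟩ := hg'.diapsisAt_next (by omega)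
      (fun hx => by have := hS _ hx; omega) (fun hx => by have := hS _ hx; omega) l
    refine ⟨g', ?_, h2⟩
    change diapsisAt (i + 1) (action n (block n i j) (f, l)) = _
    rw [hg, h1]

theorem exists_hasShape_prod_block (n l m k : ℕ) (a b : Fin k → ℕ)
    (hab : ∀ t, 1 ≤ a t ∧ a t ≤ b t ∧ b t ≤ n - 1) (ha : StrictMono a) (hb : StrictMono b)
    (hm : ∀ t, m ≤ a t) :
    ∃ g, action n (List.ofFn fun t => block n (b t) (a t)).prod (unitMatching, l) = (g, l) ∧
      HasShape g m (Set.range fun t => b t + 1) (Set.range a) := by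
  induction k generalizing m with
  | zero => exact ⟨_, by simp; rfl, by simpa using hasShape_unitMatching m⟩
  | succ k ih =>
    obtain ⟨g, hg, hg'⟩ := ih (a 0 + 1) (fun t => a t.succ) (fun t => b t.succ)
      (fun t => hab t.succ) (fun _ _ h => ha (Fin.succ_lt_succ_iff.2 h))
      (fun _ _ h => hb (Fin.succ_lt_succ_iff.2 h)) (fun t => ha (Fin.succ_pos t))
    obtain ⟨g', h1, h2⟩ := hg'.action_block (hab 0).1 (hab 0).2.1 (hab 0).2.2
      (by rintro _ ⟨t, rfl⟩; simpa using hb (Fin.succ_pos t)) l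
    refine ⟨g', ?_, ?_⟩
    · rw [List.ofFn_succ, List.prod_cons, map_mul]
      change action n _ (action n _ _) = _
      rw [hg, h1]
    · rw [← Fin.cons_self_tail a, ← Fin.cons_self_tail (fun t => b t + 1), Fin.range_cons,
        Fin.range_cons]
      exact h2.mono (hm 0)

end Kauffman


open Kauffman in
/-- Uniqueness of the Jones normal form: if two Jones normal
form data determine equal elements of `K n`, then the data coincide. -/
theorem kauffman_jones_normal_form_unique (n : ℕ) (hn : 2 ≤ n)
    (l l' k k' : ℕ) (a b : Fin k → ℕ) (a' b' : Fin k' → ℕ)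
    (hab : ∀ t, 1 ≤ a t ∧ a t ≤ b t ∧ b t ≤ n - 1)
    (ha : StrictMono a) (hb : StrictMono b)
    (hab' : ∀ t, 1 ≤ a' t ∧ a' t ≤ b' t ∧ b' t ≤ n - 1)
    (ha' : StrictMono a') (hb' : StrictMono b')
    (heq : (cK n) ^ l * (List.ofFn fun t => block n (b t) (a t)).prod =
           (cK n) ^ l' * (List.ofFn fun t => block n (b' t) (a' t)).prod) :
    l = l' ∧ ∃ hk : k = k',
      ∀ t : Fin k, a t = a' (Fin.cast hk t) ∧ b t = b' (Fin.cast hk t) := by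
  obtain ⟨g, hg, hs⟩ := exists_hasShape_prod_block n 0 0 k a b hab ha hb fun t => Nat.zero_le _
  obtain ⟨g', hg', hs'⟩ :=
    exists_hasShape_prod_block n 0 0 k' a' b' hab' ha' hb' fun t => Nat.zero_le _
  have key := congrArg (fun x => action n x (unitMatching, 0)) heq
  simp only [map_mul, map_pow, action_cK] at key
  change (Matching.circle ^ l) (action n _ _) = (Matching.circle ^ l') (action n _ _) at key
  rw [hg, hg', Matching.circle_pow_apply, Matching.circle_pow_apply, Prod.mk.injEq] at key
  obtain ⟨rfl, hl⟩ := key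
  have hA : Set.range a = Set.range a' := Set.ext fun x => (hs.bottom x).symm.trans (hs'.bottom x)
  have hB : (Set.range fun t => b t + 1) = Set.range fun t => b' t + 1 :=
    Set.ext fun x => (hs.top x).symm.trans (hs'.top x)
  have hk : k = k' := by
    have := congrArg Set.ncard hA
    rwa [Set.ncard_range_of_injective ha.injective, Set.ncard_range_of_injective ha'.injective,
      Nat.card_fin, Nat.card_fin] at this
  subst hk
  refine ⟨by simpa using hl, rfl, fun t => ⟨?_, ?_⟩⟩
  · exact congrFun ((ha.range_inj ha').1 hA) t
  · exact Nat.succ_injective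
      (congrFun (((hb.add_const 1).range_inj (hb'.add_const 1)).1 hB) t)
end

section
/- For every integer n ≥ 2, every element of the Kauffman monoid K_n is equal in K_n to an element in the dual normal form c^l h_{[a_1,b_1]} ⋯ h_{[a_k,b_k]}, where l ≥ 0, k ≥ 0, 1 ≤ a_t ≤ b_t ≤ n−1 for each t, a_1 > … > a_k and b_1 > … > b_k, and where the ascending block h_{[i,j]} (for i ≤ j) denotes the product h^i h^{i+1} ⋯ h^{j−1} h^j. -/
namespace Kauffman

/-- The ascending block `h_{[i,j]} = h^i h^{i+1} ⋯ h^{j-1} h^j` (for `i ≤ j`). -/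
def ablock (n i j : ℕ) : K n :=
  (((List.range (j + 1 - i)).map fun t => hK n (i + t))).prod

end Kauffman

namespace Kauffman

variable {n : ℕ}

theorem hK_of_mem {i : ℕ} (h : 1 ≤ i ∧ i ≤ n - 1) :
    hK n i = ((FreeMonoid.of (Gen.h ⟨i, h⟩) : FreeMonoid (Gen n)) : K n) :=
  dif_pos h

theorem hK_of_not_mem {i : ℕ} (h : ¬(1 ≤ i ∧ i ≤ n - 1)) : hK n i = 1 :=
  dif_neg h

theorem coe_eq_coe_of_rel {x y : FreeMonoid (Gen n)} (h : Rel n x y) : (x : K n) = (y : K n) :=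
  (Con.eq _).2 (ConGen.Rel.of _ _ h)

theorem commute_hK_hK {i j : ℕ} (hij : i + 2 ≤ j) : Commute (hK n i) (hK n j) := by
  by_cases hi : 1 ≤ i ∧ i ≤ n - 1
  · by_cases hj : 1 ≤ j ∧ j ≤ n - 1
    · rw [hK_of_mem hi, hK_of_mem hj]
      exact coe_eq_coe_of_rel (Rel.comm ⟨i, hi⟩ ⟨j, hj⟩ (Or.inl hij))
    · rw [hK_of_not_mem hj]
      exact Commute.one_right _
  · rw [hK_of_not_mem hi]
    exact Commute.one_left _

theorem commute_cK_hK (i : ℕ) : Commute (cK n) (hK n i) := by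
  by_cases hi : 1 ≤ i ∧ i ≤ n - 1
  · rw [hK_of_mem hi]
    exact (coe_eq_coe_of_rel (Rel.hc ⟨i, hi⟩)).symm
  · rw [hK_of_not_mem hi]
    exact Commute.one_right _

theorem hK_mul_self {i : ℕ} (h₁ : 1 ≤ i) (h₂ : i ≤ n - 1) :
    hK n i * hK n i = cK n * hK n i := by
  rw [hK_of_mem ⟨h₁, h₂⟩]
  exact coe_eq_coe_of_rel (Rel.hh ⟨i, h₁, h₂⟩)

theorem hK_mul_hK_succ_mul_hK {i : ℕ} (h₁ : 1 ≤ i) (h₂ : i + 1 ≤ n - 1) :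
    hK n i * hK n (i + 1) * hK n i = hK n i := by
  rw [hK_of_mem (i := i) ⟨h₁, by omega⟩, hK_of_mem (i := i + 1) ⟨by omega, h₂⟩]
  exact coe_eq_coe_of_rel (Rel.absorb ⟨i, _⟩ ⟨i + 1, _⟩ (Or.inl rfl))

theorem hK_succ_mul_hK_mul_hK_succ {i : ℕ} (h₁ : 1 ≤ i) (h₂ : i + 1 ≤ n - 1) :
    hK n (i + 1) * hK n i * hK n (i + 1) = hK n (i + 1) := by
  rw [hK_of_mem (i := i) ⟨h₁, by omega⟩, hK_of_mem (i := i + 1) ⟨by omega, h₂⟩]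
  exact coe_eq_coe_of_rel (Rel.absorb ⟨i + 1, _⟩ ⟨i, _⟩ (Or.inr rfl))

theorem ablock_eq_one {i j : ℕ} (h : j < i) : ablock n i j = 1 := by
  simp [ablock, Nat.sub_eq_zero_of_le (Nat.succ_le_of_lt h)]

theorem ablock_self (i : ℕ) : ablock n i i = hK n i := by
  simp [ablock]

theorem ablock_mul_ablock {i j k : ℕ} (hij : i ≤ j + 1) (hjk : j ≤ k) :
    ablock n i j * ablock n (j + 1) k = ablock n i k := by
  have hk : k + 1 - i = (j + 1 - i) + (k + 1 - (j + 1)) := by omega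
  unfold ablock
  rw [hk, List.range_add, List.map_append, List.prod_append, List.map_map]
  congr 2
  refine List.map_congr_left fun t _ => ?_
  simp only [Function.comp_apply]
  congr 1
  omega

theorem ablock_mul_hK {i j : ℕ} (hij : i ≤ j + 1) :
    ablock n i j * hK n (j + 1) = ablock n i (j + 1) := by
  rw [← ablock_self, ablock_mul_ablock hij (Nat.le_succ j)]

theorem hK_mul_ablock {i j : ℕ} (hij : i ≤ j) :
    hK n i * ablock n (i + 1) j = ablock n i j := by
  rw [← ablock_self, ablock_mul_ablock (Nat.le_succ i) hij]

theorem commute_ablock_right {x : K n} {i j : ℕ}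
    (h : ∀ k, i ≤ k → k ≤ j → Commute x (hK n k)) : Commute x (ablock n i j) := by
  refine Commute.list_prod_right _ _ fun y hy => ?_
  obtain ⟨t, ht, rfl⟩ := List.mem_map.1 hy
  rw [List.mem_range] at ht
  exact h _ (by omega) (by omega)

theorem commute_hK_ablock {i j k : ℕ} (h : k + 2 ≤ i) : Commute (hK n k) (ablock n i j) :=
  commute_ablock_right fun _ hi _ => commute_hK_hK (by omega)

theorem commute_ablock_hK {i j k : ℕ} (h : j + 2 ≤ k) : Commute (ablock n i j) (hK n k) :=
  (commute_ablock_right fun _ _ hj => (commute_hK_hK (by omega)).symm).symm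

theorem commute_ablock_ablock {i j k l : ℕ} (h : j + 2 ≤ k) :
    Commute (ablock n i j) (ablock n k l) :=
  commute_ablock_right fun _ hk _ => commute_ablock_hK (by omega)

theorem commute_cK_ablock (i j : ℕ) : Commute (cK n) (ablock n i j) :=
  commute_ablock_right fun k _ _ => commute_cK_hK k

/-- Two blocks whose left ends are out of order can be exchanged for two blocks in order. -/
theorem ablock_mul_ablock_of_le {a m i j : ℕ} (ha : 1 ≤ a) (hai : a ≤ i) (hij : i ≤ j)
    (hjm : j < m) (hm : m ≤ n - 1) :
    ablock n a m * ablock n i j = ablock n (i + 2) m * ablock n a j := by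
  obtain ⟨s, rfl⟩ : ∃ s, i = s + 1 := ⟨i - 1, by omega⟩
  have h₁ : ablock n a m =
      ablock n a s * (hK n (s + 1) * (hK n (s + 1 + 1) * ablock n (s + 1 + 2) m)) := by
    rw [hK_mul_ablock (by omega), hK_mul_ablock (by omega), ablock_mul_ablock hai (by omega)]
  calc ablock n a m * ablock n (s + 1) j
      = ablock n a s * (hK n (s + 1) * hK n (s + 1 + 1) *
          (ablock n (s + 1 + 2) m * hK n (s + 1)) * ablock n (s + 1 + 1) j) := by
        rw [h₁, ← hK_mul_ablock hij]
        simp only [mul_assoc]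
    _ = ablock n a s * (hK n (s + 1) * hK n (s + 1 + 1) * hK n (s + 1) *
          ablock n (s + 1 + 2) m * ablock n (s + 1 + 1) j) := by
        rw [← (commute_hK_ablock le_rfl).eq]
        simp only [mul_assoc]
    _ = ablock n a (s + 1) * ablock n (s + 1 + 2) m * ablock n (s + 1 + 1) j := by
        rw [hK_mul_hK_succ_mul_hK (by omega) (by omega), ← ablock_mul_hK hai]
        simp only [mul_assoc]
    _ = ablock n (s + 1 + 2) m * ablock n a j := by
        rw [(commute_ablock_ablock le_rfl).eq, mul_assoc, ablock_mul_ablock (by omega) hij]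

theorem hK_mul_ablock_of_lt {a m s : ℕ} (has : a ≤ s + 1) (hsm : s + 2 ≤ m)
    (hm : m ≤ n - 1) :
    hK n (s + 2) * ablock n a m = ablock n (s + 2) m * ablock n a s := by
  have h₁ : ablock n a m =
      ablock n a s * (hK n (s + 1) * (hK n (s + 1 + 1) * ablock n (s + 1 + 2) m)) := by
    rw [hK_mul_ablock (by omega), hK_mul_ablock (by omega), ablock_mul_ablock has (by omega)]
  calc hK n (s + 2) * ablock n a m
      = ablock n a s * (hK n (s + 1 + 1) * hK n (s + 1) * hK n (s + 1 + 1) *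
          ablock n (s + 1 + 2) m) := by
        rw [h₁, ← mul_assoc, ← (commute_ablock_hK le_rfl).eq]
        simp only [mul_assoc]
    _ = ablock n a s * ablock n (s + 2) m := by
        rw [hK_succ_mul_hK_mul_hK_succ (by omega) (by omega), hK_mul_ablock hsm]
    _ = ablock n (s + 2) m * ablock n a s := (commute_ablock_ablock le_rfl).eq

/-- The submonoid of `K n` generated by `c` and `h^1, …, h^m`. -/
def lower (n m : ℕ) : Submonoid (K n) :=
  Submonoid.closure (insert (cK n) (hK n '' Set.Icc 1 m))

theorem cK_mem_lower (m : ℕ) : cK n ∈ lower n m :=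
  Submonoid.subset_closure (Set.mem_insert _ _)

theorem hK_mem_lower {i m : ℕ} (h₁ : 1 ≤ i) (h₂ : i ≤ m) : hK n i ∈ lower n m :=
  Submonoid.subset_closure (Set.mem_insert_of_mem _ ⟨i, ⟨h₁, h₂⟩, rfl⟩)

theorem ablock_mem_lower {i j m : ℕ} (hi : 1 ≤ i) (hj : j ≤ m) : ablock n i j ∈ lower n m := by
  refine Submonoid.list_prod_mem _ fun y hy => ?_
  obtain ⟨t, ht, rfl⟩ := List.mem_map.1 hy
  rw [List.mem_range] at ht
  exact hK_mem_lower (by omega) (by omega)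

theorem mem_lower_pred (x : K n) : x ∈ lower n (n - 1) := by
  induction x using Con.induction_on with
  | H w =>
    induction w using FreeMonoid.inductionOn' with
    | one => exact one_mem _
    | of_mul g w ih =>
      rw [Con.coe_mul]
      refine mul_mem ?_ ih
      cases g with
      | c => exact cK_mem_lower _
      | h i =>
        have := hK_mem_lower (n := n) i.2.1 i.2.2
        rwa [hK_of_mem i.2] at this

/-- An element of `lower n (m + 1)` splits off a block ending in `m + 1` (empty if `a = m + 2`). -/
theorem exists_eq_ablock_mul {m : ℕ} (hm : m + 1 ≤ n - 1) {x : K n} (hx : x ∈ lower n (m + 1)) :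
    ∃ a, 1 ≤ a ∧ a ≤ m + 2 ∧ ∃ y ∈ lower n m, x = ablock n a (m + 1) * y := by
  induction hx using Submonoid.closure_induction_left with
  | one => exact ⟨m + 2, by omega, le_rfl, 1, one_mem _, by rw [ablock_eq_one (by omega), mul_one]⟩
  | mul_left g hg x _ ih =>
    obtain ⟨a, ha₁, ha₂, y, hy, rfl⟩ := ih
    rcases hg with rfl | ⟨i, ⟨hi₁, hi₂⟩, rfl⟩
    · exact ⟨a, ha₁, ha₂, cK n * y, mul_mem (cK_mem_lower m) hy, by
        rw [← mul_assoc, (commute_cK_ablock _ _).eq, mul_assoc]⟩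
    · rcases lt_trichotomy (i + 1) a with h | rfl | h
      · exact ⟨a, ha₁, ha₂, hK n i * y, mul_mem (hK_mem_lower hi₁ (by omega)) hy, by
          rw [← mul_assoc, (commute_hK_ablock h).eq, mul_assoc]⟩
      · exact ⟨i, hi₁, by omega, y, hy, by rw [← mul_assoc, hK_mul_ablock hi₂]⟩
      · rcases (Nat.lt_succ_iff.1 h).eq_or_lt with rfl | h
        · refine ⟨a, ha₁, ha₂, cK n * y, mul_mem (cK_mem_lower m) hy, ?_⟩
          rw [← hK_mul_ablock hi₂, ← mul_assoc, ← mul_assoc, hK_mul_self hi₁ (by omega),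
            mul_assoc (cK n), hK_mul_ablock hi₂, (commute_cK_ablock _ _).eq, mul_assoc]
        · obtain ⟨s, rfl⟩ : ∃ s, i = s + 2 := ⟨i - 2, by omega⟩
          exact ⟨s + 2, by omega, by omega, ablock n a s * y,
            mul_mem (ablock_mem_lower ha₁ (by omega)) hy, by
            rw [← mul_assoc, hK_mul_ablock_of_lt (by omega) hi₂ hm, mul_assoc]⟩

/-- `x` has a dual normal form all of whose blocks end at most in `m`. -/
def HasDualNormalForm (n m : ℕ) (x : K n) : Prop :=
  ∃ (l : ℕ) (L : List (ℕ × ℕ)),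
    (∀ p ∈ L, 1 ≤ p.1 ∧ p.1 ≤ p.2 ∧ p.2 ≤ m) ∧
    L.Pairwise (fun p q => q.1 < p.1 ∧ q.2 < p.2) ∧
    x = cK n ^ l * (L.map fun p => ablock n p.1 p.2).prod

theorem HasDualNormalForm.mono {m m' : ℕ} (h : m ≤ m') {x : K n}
    (hx : HasDualNormalForm n m x) : HasDualNormalForm n m' x := by
  obtain ⟨l, L, hL, hP, rfl⟩ := hx
  exact ⟨l, L, fun p hp => ⟨(hL p hp).1, (hL p hp).2.1, (hL p hp).2.2.trans h⟩, hP, rfl⟩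

theorem HasDualNormalForm.ablock_mul {m : ℕ} (hm : m + 1 ≤ n - 1)
    (ih : ∀ y ∈ lower n m, HasDualNormalForm n m y) (a : ℕ) (ha₁ : 1 ≤ a) (ha₂ : a ≤ m + 2)
    {y : K n} (hy : y ∈ lower n m) :
    HasDualNormalForm n (m + 1) (ablock n a (m + 1) * y) := by
  induction hd : m + 2 - a using Nat.strong_induction_on generalizing a y with
  | _ d IH =>
    subst hd
    rcases ha₂.eq_or_lt with rfl | ha
    · rw [ablock_eq_one (by omega), one_mul]
      exact (ih y hy).mono (Nat.le_succ m)
    obtain ⟨l, L, hL, hP, rfl⟩ := ih y hy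
    by_cases hlt : ∀ p ∈ L, p.1 < a
    · refine ⟨l, (a, m + 1) :: L, ?_, ?_, ?_⟩
      · rintro p (_ | ⟨_, hp⟩)
        · exact ⟨ha₁, by omega, le_rfl⟩
        · exact ⟨(hL p hp).1, (hL p hp).2.1, (hL p hp).2.2.trans (Nat.le_succ m)⟩
      · exact List.pairwise_cons.2 ⟨fun p hp => ⟨hlt p hp, Nat.lt_succ_of_le (hL p hp).2.2⟩, hP⟩
      · rw [List.map_cons, List.prod_cons, ← mul_assoc, ← mul_assoc,
          ((commute_cK_ablock _ _).pow_left l).eq]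
    · rcases L with _ | ⟨⟨i, j⟩, L⟩
      · simp at hlt
      rw [List.pairwise_cons] at hP
      have hai : a ≤ i := by
        by_contra! h
        refine hlt fun p hp => ?_
        rcases List.mem_cons.1 hp with rfl | hp
        · exact h
        · exact (hP.1 p hp).1.trans h
      obtain ⟨hi, hij, hj⟩ := hL (i, j) List.mem_cons_self
      dsimp only at hi hij hj
      have key : ablock n a (m + 1) *
          (cK n ^ l * (((i, j) :: L).map fun p => ablock n p.1 p.2).prod) =
          ablock n (i + 2) (m + 1) *
            (cK n ^ l * (ablock n a j * (L.map fun p => ablock n p.1 p.2).prod)) := by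
        rw [List.map_cons, List.prod_cons, ← mul_assoc,
          ← ((commute_cK_ablock _ _).pow_left l).eq, mul_assoc, ← mul_assoc (ablock n a (m + 1)),
          ablock_mul_ablock_of_le ha₁ hai hij (Nat.lt_succ_of_le hj) hm, mul_assoc, ← mul_assoc,
          ((commute_cK_ablock _ _).pow_left l).eq, mul_assoc]
      rw [key]
      refine IH _ (by omega) (i + 2) (by omega) (by omega) ?_ rfl
      refine mul_mem (pow_mem (cK_mem_lower m) l) (mul_mem (ablock_mem_lower ha₁ hj) ?_)
      refine Submonoid.list_prod_mem _ fun z hz => ?_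
      obtain ⟨p, hp, rfl⟩ := List.mem_map.1 hz
      have := hL p (List.mem_cons_of_mem _ hp)
      exact ablock_mem_lower this.1 this.2.2

theorem hasDualNormalForm_of_mem_lower {m : ℕ} (hm : m ≤ n - 1) {x : K n} (hx : x ∈ lower n m) :
    HasDualNormalForm n m x := by
  induction m generalizing x with
  | zero =>
    rw [lower, Set.Icc_eq_empty (by omega), Set.image_empty, insert_empty_eq,
      Submonoid.mem_closure_singleton] at hx
    obtain ⟨l, rfl⟩ := hx
    exact ⟨l, [], by simp, List.Pairwise.nil, by simp⟩
  | succ m ih =>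
    obtain ⟨a, ha₁, ha₂, y, hy, rfl⟩ := exists_eq_ablock_mul hm hx
    exact HasDualNormalForm.ablock_mul hm (fun y hy => ih (by omega) hy) a ha₁ ha₂ hy

end Kauffman

open Kauffman in
/-- Every element of `K n` equals some
`c^l h_{[a_1,b_1]} ⋯ h_{[a_k,b_k]}` in the dual normal form, with
`1 ≤ a_t ≤ b_t ≤ n-1`, `a_1 > … > a_k` and `b_1 > … > b_k`. -/
theorem kauffman_dual_normal_form_exists (n : ℕ) (hn : 2 ≤ n) (x : K n) :
    ∃ (l k : ℕ) (a b : Fin k → ℕ),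
      (∀ t, 1 ≤ a t ∧ a t ≤ b t ∧ b t ≤ n - 1) ∧
      StrictAnti a ∧ StrictAnti b ∧
      x = (cK n) ^ l * (List.ofFn fun t => ablock n (a t) (b t)).prod := by
  obtain ⟨l, L, hL, hP, rfl⟩ := hasDualNormalForm_of_mem_lower le_rfl (mem_lower_pred x)
  rw [List.pairwise_iff_get] at hP
  refine ⟨l, L.length, fun t => (L.get t).1, fun t => (L.get t).2,
    fun t => hL _ (L.get_mem t), fun s t h => (hP s t h).1, fun s t h => (hP s t h).2, ?_⟩
  congr 2
  conv_lhs => rw [← List.ofFn_get L, List.map_ofFn]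
  rfl
end
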